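/- Let k be a field of arbitrary characteristic, let R and S be polynomial rings over k in at least one variable each, with graded maximal ideals m and n, let I ⊆ m² and J ⊆ n² be proper homogeneous ideals at least one of which is non-zero, let T = R ⊗_k S, and let F = I + J + mn ⊆ T. Then for every integer s ≥ 2 one has depth(T/F^s) = 0; equivalently, the graded maximal ideal mT + nT is an associated prime of T/F^s. -/

import Mathlib

/- STATEMENT 18: k a field of arbitrary characteristic, R and S polynomial rings over k
in at least one variable each with graded maximal ideals m and n, I ⊆ m² and J ⊆ n²
proper homogeneous ideals at least one of which is non-zero, T = R ⊗_k S, F = I + J + mn.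
Then for every s ≥ 2: depth(T/F^s) = 0; equivalently, the graded maximal ideal mT + nT
is an associated prime of T/F^s. -/

open MvPolynomial

noncomputable section

/-- The graded maximal ideal of a polynomial ring, generated by the variables. -/
def mxI (k : Type*) [Field k] (σ : Type*) : Ideal (MvPolynomial σ k) :=
  Ideal.span (Set.range MvPolynomial.X)

/-- An ideal of a polynomial ring is homogeneous if it contains every homogeneous
component of each of its elements. -/
def IsHomogIdeal {k : Type*} [Field k] {σ : Type*} (I : Ideal (MvPolynomial σ k)) : Prop :=
  ∀ f ∈ I, ∀ d : ℕ, MvPolynomial.homogeneousComponent d f ∈ I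

/-- Depth of a module `M` with respect to an ideal `p`: the supremum of the lengths of
`M`-regular sequences consisting of elements of `p`. -/
def seqDepth {A : Type*} [CommRing A] (p : Ideal A) (M : Type*) [AddCommGroup M]
    [Module A M] : ℕ :=
  sSup {l : ℕ | ∃ rs : List A, rs.length = l ∧ (∀ r ∈ rs, r ∈ p) ∧
    RingTheory.Sequence.IsRegular M rs}

/-- The ideal of polynomials all of whose monomials have `w`-weight at least `N`. -/
def weightGE (k : Type*) [Field k] {ρ : Type*} (w : ρ → ℕ) (N : ℕ) :
    Ideal (MvPolynomial ρ k) :=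
  restrictSupportIdeal k {e | N ≤ Finsupp.weight w e} (by
    intro e f hef he
    obtain ⟨g, rfl⟩ := exists_add_of_le hef
    simp only [Set.mem_ofPred_eq, map_add] at he ⊢
    omega)

lemma mem_weightGE {k : Type*} [Field k] {ρ : Type*} {w : ρ → ℕ} {N : ℕ}
    {p : MvPolynomial ρ k} :
    p ∈ weightGE k w N ↔ ∀ e, coeff e p ≠ 0 → N ≤ Finsupp.weight w e := by
  exact (mem_restrictSupport_iff k).trans
    ⟨fun h e he => h (MvPolynomial.mem_support_iff.2 he),
      fun h e he => h e (MvPolynomial.mem_support_iff.1 he)⟩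

lemma weightGE_anti {k : Type*} [Field k] {ρ : Type*} (w : ρ → ℕ) {M N : ℕ} (h : M ≤ N) :
    weightGE k w N ≤ weightGE k w M :=
  fun _ hp => mem_weightGE.2 fun e he => h.trans (mem_weightGE.1 hp e he)

lemma weightGE_mul_le {k : Type*} [Field k] {ρ : Type*} (w : ρ → ℕ) (M N : ℕ) :
    weightGE k w M * weightGE k w N ≤ weightGE k w (M + N) := by
  classical
  rw [Ideal.mul_le]
  intro p hp q hq
  rw [mem_weightGE] at *
  intro e he
  obtain ⟨x, hx, y, hy, rfl⟩ :=
    Finset.mem_add.1 (support_mul p q (MvPolynomial.mem_support_iff.2 he))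
  rw [map_add]
  exact add_le_add (hp x (MvPolynomial.mem_support_iff.1 hx))
    (hq y (MvPolynomial.mem_support_iff.1 hy))

lemma weightGE_pow_le {k : Type*} [Field k] {ρ : Type*} (w : ρ → ℕ) (N s : ℕ) :
    weightGE k w N ^ s ≤ weightGE k w (s * N) := by
  induction s with
  | zero => exact fun p _ => mem_weightGE.2 fun e _ => by simp
  | succ s ih =>
    rw [pow_succ, Nat.succ_mul]
    exact (Ideal.mul_mono_left ih).trans (weightGE_mul_le w _ _)

lemma weight_mapDomain_of_const {σ ρ : Type*} {w : ρ → ℕ} {i : σ → ρ} {c : ℕ}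
    (hc : ∀ x, w (i x) = c) (e : σ →₀ ℕ) :
    Finsupp.weight w (e.mapDomain i) = e.degree * c := by
  rw [Finsupp.weight_apply, Finsupp.sum_mapDomain_index (by simp) (by intros; simp [add_mul])]
  simp [hc, Finsupp.sum, Finsupp.degree_apply, Finset.sum_mul]

lemma map_rename_le_weightGE {k : Type*} [Field k] {σ ρ : Type*} {w : ρ → ℕ} {i : σ → ρ}
    {c N : ℕ} (hc : ∀ x, w (i x) = c) {L : Ideal (MvPolynomial σ k)}
    (hL : ∀ f ∈ L, ∀ e, coeff e f ≠ 0 → N ≤ e.degree) :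
    L.map (rename i : MvPolynomial σ k →ₐ[k] MvPolynomial ρ k) ≤ weightGE k w (N * c) := by
  rw [Ideal.map_le_iff_le_comap]
  intro f hf
  rw [Ideal.mem_comap, mem_weightGE]
  intro e he
  obtain ⟨u, rfl, hu⟩ := coeff_rename_ne_zero i f e he
  rw [weight_mapDomain_of_const hc]
  exact Nat.mul_le_mul_right c (hL f hf u hu)

lemma le_degree_of_mem_mxI_pow {k : Type*} [Field k] {σ : Type*} {N : ℕ}
    {f : MvPolynomial σ k} (hf : f ∈ mxI k σ ^ N) (e : σ →₀ ℕ) (he : coeff e f ≠ 0) :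
    N ≤ e.degree := by
  by_contra! h
  exact he ((mem_pow_idealOfVars_iff' N f).1 hf e h)

/-- If `I ≤ m²` is non-zero and `J ≤ n²`, then for `s ≥ 2` there is an element outside
`(I + J + mn) ^ s` which is multiplied into it by `m + n`. -/
lemma exists_socle_witness {k : Type*} [Field k] {σ τ ρ : Type*} (i : σ → ρ) (j : τ → ρ)
    (hi : Function.Injective i) (hij : ∀ x y, i x ≠ j y) (x : σ) (y : τ)
    {I : Ideal (MvPolynomial σ k)} {J : Ideal (MvPolynomial τ k)}
    (hI : I ≤ mxI k σ ^ 2) (hJ : J ≤ mxI k τ ^ 2) (hI0 : I ≠ ⊥)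
    {I' J' m' n' F : Ideal (MvPolynomial ρ k)}
    (hI' : I' = I.map (rename i : MvPolynomial σ k →ₐ[k] MvPolynomial ρ k))
    (hJ' : J' = J.map (rename j : MvPolynomial τ k →ₐ[k] MvPolynomial ρ k))
    (hm' : m' = (mxI k σ).map (rename i : MvPolynomial σ k →ₐ[k] MvPolynomial ρ k))
    (hn' : n' = (mxI k τ).map (rename j : MvPolynomial τ k →ₐ[k] MvPolynomial ρ k))
    (hF : F = I' + J' + m' * n') {s : ℕ} (hs : 2 ≤ s) :
    ∃ u, u ∉ F ^ s ∧ ∀ p ∈ m' + n', p * u ∈ F ^ s := by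
  classical
  obtain ⟨t, rfl⟩ : ∃ t, s = t + 2 := ⟨s - 2, by omega⟩
  have hex : ∃ d, ∃ f ∈ I, ∃ e, coeff e f ≠ 0 ∧ e.degree = d := by
    obtain ⟨f, hf, hf0⟩ := Submodule.exists_mem_ne_zero_of_ne_bot hI0
    obtain ⟨e, he⟩ := MvPolynomial.ne_zero_iff.1 hf0
    exact ⟨_, f, hf, e, he, rfl⟩
  obtain ⟨d, ⟨f, hf, e, he, hed⟩, hmin⟩ :
      ∃ d, (∃ f ∈ I, ∃ e, coeff e f ≠ 0 ∧ e.degree = d) ∧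
        ∀ f ∈ I, ∀ e, coeff e f ≠ 0 → d ≤ e.degree :=
    ⟨Nat.find hex, Nat.find_spec hex, fun f hf e he => Nat.find_min' hex ⟨f, hf, e, he, rfl⟩⟩
  have hd : 2 ≤ d := hed ▸ le_degree_of_mem_mxI_pow (hI hf) e he
  have hxm : X (i x) ∈ m' := by
    have := Ideal.mem_map_of_mem (rename i : MvPolynomial σ k →ₐ[k] MvPolynomial ρ k)
      (show X x ∈ mxI k σ from Ideal.subset_span ⟨x, rfl⟩)
    rwa [rename_X, ← hm'] at this
  have hyn : X (j y) ∈ n' := by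
    have := Ideal.mem_map_of_mem (rename j : MvPolynomial τ k →ₐ[k] MvPolynomial ρ k)
      (show X y ∈ mxI k τ from Ideal.subset_span ⟨y, rfl⟩)
    rwa [rename_X, ← hn'] at this
  have hfI : rename i f ∈ I' := hI' ▸ Ideal.mem_map_of_mem _ hf
  have hfm : rename i f ∈ m' ^ 2 := by
    rw [hm', ← Ideal.map_pow]
    exact Ideal.mem_map_of_mem _ (hI hf)
  have hIF : I' ≤ F := hF ▸ le_sup_left.trans le_sup_left
  have hmnF : m' * n' ≤ F := hF ▸ le_sup_right
  have hxy : (X (i x) * X (j y) : MvPolynomial ρ k) ^ t ∈ F ^ t :=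
    Ideal.pow_mem_pow (hmnF (Ideal.mul_mem_mul hxm hyn)) t
  refine ⟨rename i f * X (j y) * (X (i x) * X (j y)) ^ t, fun hu => ?_, fun p hp => ?_⟩
  · set w : ρ → ℕ := fun r => if r ∈ Set.range i then 1 else d - 1 with hw
    have hwi : ∀ a, w (i a) = 1 := fun a => if_pos ⟨a, rfl⟩
    have hwj : ∀ b, w (j b) = d - 1 := fun b => if_neg fun ⟨a, ha⟩ => hij a b ha
    have hFw : F ≤ weightGE k w d := by
      rw [hF]
      refine sup_le (sup_le ?_ ?_) ?_
      · rw [hI']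
        simpa using map_rename_le_weightGE hwi hmin
      · rw [hJ']
        exact (map_rename_le_weightGE hwj fun f hf => le_degree_of_mem_mxI_pow (hJ hf)).trans
          (weightGE_anti w (by omega))
      · rw [hm', hn']
        refine (Ideal.mul_mono
          (map_rename_le_weightGE (N := 1) hwi fun f hf => le_degree_of_mem_mxI_pow (by simpa using hf))
          (map_rename_le_weightGE (N := 1) hwj fun f hf =>
            le_degree_of_mem_mxI_pow (by simpa using hf))).trans
          ((weightGE_mul_le w _ _).trans (weightGE_anti w (by omega)))
    have huw := weightGE_pow_le w d (t + 2) (Ideal.pow_right_mono hFw _ hu)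
    have hmon : rename i f * X (j y) * (X (i x) * X (j y)) ^ t =
        rename i f * monomial (Finsupp.single (j y) 1 +
          t • (Finsupp.single (i x) 1 + Finsupp.single (j y) 1)) 1 := by
      rw [mul_assoc]
      simp [X, monomial_mul, monomial_pow]
    rw [hmon, mem_weightGE] at huw
    have h := huw (e.mapDomain i + (Finsupp.single (j y) 1 +
          t • (Finsupp.single (i x) 1 + Finsupp.single (j y) 1))) (by
      rw [coeff_mul_monomial, coeff_rename_mapDomain i hi]
      simpa using he)
    simp only [map_add, map_nsmul, weight_mapDomain_of_const hwi, Finsupp.weight_single, hwi, hwj,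
      hed, smul_eq_mul, one_mul, mul_one] at h
    obtain ⟨c, rfl⟩ : ∃ c, d = c + 1 := ⟨d - 1, by omega⟩
    simp only [Nat.add_sub_cancel] at h
    nlinarith
  · obtain ⟨q, hq, r, hr, rfl⟩ := Submodule.mem_sup.1 hp
    rw [add_mul]
    refine add_mem ?_ ?_
    · have h : rename i f * (q * X (j y)) * (X (i x) * X (j y)) ^ t ∈ F * F * F ^ t :=
        Ideal.mul_mem_mul (Ideal.mul_mem_mul (hIF hfI) (hmnF (Ideal.mul_mem_mul hq hyn))) hxy
      convert h using 1 <;> ring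
    · have h2 : rename i f * (r * X (j y)) ∈ F ^ 2 := by
        refine Ideal.pow_right_mono hmnF 2 ?_
        rw [mul_pow]
        exact Ideal.mul_mem_mul hfm (sq n' ▸ Ideal.mul_mem_mul hr hyn)
      have h := Ideal.mul_mem_mul h2 hxy
      convert h using 1 <;> ring

lemma mxI_isMaximal (k : Type*) [Field k] (σ : Type*) : (mxI k σ).IsMaximal := by
  have h : mxI k σ = RingHom.ker (constantCoeff : MvPolynomial σ k →+* k) := by
    ext f
    rw [← pow_one (mxI k σ), RingHom.mem_ker, constantCoeff_eq]
    refine (mem_pow_idealOfVars_iff' 1 f).trans ⟨fun h => h 0 (by simp), fun h e he => ?_⟩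
    rw [Nat.lt_one_iff, Finsupp.degree_eq_zero_iff] at he
    rwa [he]
  rw [h]
  exact RingHom.ker_isMaximal_of_surjective _ fun c => ⟨C c, constantCoeff_C _ c⟩

lemma map_mxI_inl_add_map_mxI_inr (k : Type*) [Field k] (σ τ : Type*) :
    (mxI k σ).map (rename Sum.inl : MvPolynomial σ k →ₐ[k] MvPolynomial (σ ⊕ τ) k) +
      (mxI k τ).map (rename Sum.inr : MvPolynomial τ k →ₐ[k] MvPolynomial (σ ⊕ τ) k) =
      mxI k (σ ⊕ τ) := by
  rw [mxI, mxI, mxI, Ideal.map_span, Ideal.map_span, Submodule.add_eq_sup, ← Ideal.span_union]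
  congr 1
  ext p
  simp

/-- A maximal ideal killing a non-zero element of `A ⧸ Q` is an associated prime, and the depth
of `A ⧸ Q` with respect to it is zero. -/
lemma seqDepth_quotient_eq_zero {A : Type*} [CommRing A] {P Q : Ideal A} (hP : P.IsMaximal)
    {u : A} (hu : u ∉ Q) (hPu : ∀ p ∈ P, p * u ∈ Q) :
    seqDepth P (A ⧸ Q) = 0 ∧ P ∈ associatedPrimes A (A ⧸ Q) := by
  have hu0 : Ideal.Quotient.mk Q u ≠ 0 := fun h => hu (Ideal.Quotient.eq_zero_iff_mem.1 h)
  have hsmul : ∀ p ∈ P, p • Ideal.Quotient.mk Q u = 0 := fun p hp =>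
    Ideal.Quotient.eq_zero_iff_mem.2 (hPu p hp)
  constructor
  · refine Nat.le_zero.1 (csSup_le' ?_)
    rintro l ⟨rs, rfl, hrs, hreg⟩
    cases rs with
    | nil => simp
    | cons r rs =>
      have h := ((RingTheory.Sequence.isRegular_cons_iff _ r rs).1 hreg).1
      exact absurd (h.right_eq_zero_of_smul (hsmul r (hrs r (by simp)))) hu0
  · have hle : P ≤ (⊥ : Submodule A (A ⧸ Q)).colon {Ideal.Quotient.mk Q u} := fun p hp =>
      Submodule.mem_colon_singleton.2 (hsmul p hp)
    have hne : (⊥ : Submodule A (A ⧸ Q)).colon {Ideal.Quotient.mk Q u} ≠ ⊤ := fun h => by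
      have := Submodule.mem_colon_singleton.1 (h ▸ Submodule.mem_top : (1 : A) ∈ _)
      rw [one_smul] at this
      exact hu0 this
    have heq := hP.eq_of_le hne hle
    exact ⟨hP.isPrime, _, by rw [← heq, hP.isPrime.radical]⟩

theorem depth_pow_fiberProduct_eq_zero
    (k : Type*) [Field k] (a b : ℕ) (ha : 0 < a) (hb : 0 < b)
    (I : Ideal (MvPolynomial (Fin a) k)) (hIm : I ≤ mxI k (Fin a) ^ 2)
    (hIproper : I ≠ ⊤) (hIhom : IsHomogIdeal I)
    (J : Ideal (MvPolynomial (Fin b) k)) (hJn : J ≤ mxI k (Fin b) ^ 2)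
    (hJproper : J ≠ ⊤) (hJhom : IsHomogIdeal J)
    -- at least one of `I`, `J` is non-zero
    (hnz : I ≠ ⊥ ∨ J ≠ ⊥)
    (I' J' m' n' : Ideal (MvPolynomial (Fin a ⊕ Fin b) k))
    (hI' : I' = Ideal.map (rename (Sum.inl : Fin a → Fin a ⊕ Fin b) :
      MvPolynomial (Fin a) k →ₐ[k] MvPolynomial (Fin a ⊕ Fin b) k) I)
    (hJ' : J' = Ideal.map (rename (Sum.inr : Fin b → Fin a ⊕ Fin b) :
      MvPolynomial (Fin b) k →ₐ[k] MvPolynomial (Fin a ⊕ Fin b) k) J)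
    (hm' : m' = Ideal.map (rename (Sum.inl : Fin a → Fin a ⊕ Fin b) :
      MvPolynomial (Fin a) k →ₐ[k] MvPolynomial (Fin a ⊕ Fin b) k) (mxI k (Fin a)))
    (hn' : n' = Ideal.map (rename (Sum.inr : Fin b → Fin a ⊕ Fin b) :
      MvPolynomial (Fin b) k →ₐ[k] MvPolynomial (Fin a ⊕ Fin b) k) (mxI k (Fin b)))
    (F : Ideal (MvPolynomial (Fin a ⊕ Fin b) k)) (hF : F = I' + J' + m' * n')
    (s : ℕ) (hs : 2 ≤ s) :
    seqDepth (m' + n') (MvPolynomial (Fin a ⊕ Fin b) k ⧸ F ^ s) = 0 ∧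
      (m' + n') ∈ associatedPrimes (MvPolynomial (Fin a ⊕ Fin b) k)
        (MvPolynomial (Fin a ⊕ Fin b) k ⧸ F ^ s) := by
  have hmax : (m' + n').IsMaximal := by
    rw [hm', hn', map_mxI_inl_add_map_mxI_inr]
    exact mxI_isMaximal k _
  obtain ⟨u, hu, hPu⟩ : ∃ u, u ∉ F ^ s ∧ ∀ p ∈ m' + n', p * u ∈ F ^ s := by
    rcases hnz with hI0 | hJ0
    · exact exists_socle_witness Sum.inl Sum.inr Sum.inl_injective (by simp) ⟨0, ha⟩ ⟨0, hb⟩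
        hIm hJn hI0 hI' hJ' hm' hn' hF hs
    · rw [add_comm m']
      exact exists_socle_witness Sum.inr Sum.inl Sum.inr_injective (by simp) ⟨0, hb⟩ ⟨0, ha⟩
        hJn hIm hJ0 hJ' hI' hn' hm' (by rw [hF, add_comm I', mul_comm]) hs
  exact seqDepth_quotient_eq_zero hmax hu hPu

end
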